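/- Let λ > −1/2 and let j > 0 be a fixed integer. Suppose a real sequence (g_i)_{i ≥ j−1} satisfies, for every i ≥ j, the recurrence 2((i+λ)² − 1/4)(i+λ+3/2) √((i+2λ)/((i+1)(i+λ+1)(i+λ))) g_{i+1} + 2((i+λ)² − 1/4)(i+λ−3/2) √(i/((i−1+λ)(i−1+2λ)(i+λ))) g_{i−1} = (j+λ−1/2)(j+λ+1/2) [ 2(i+λ−1/2) √((i+2λ)/((i+1)(i+λ+1)(i+λ))) g_{i+1} + 4 g_i + 2(i+λ+1/2) √(i/((i−1+λ)(i−1+2λ)(i+λ))) g_{i−1} ], together with the initial conditions g_{j−1} = 0 and g_j = ∫_0^1 p̂_j^{(λ)}(t) p̂_j^{(λ)}(2t−1) (t(1−t))^{λ−1/2} dt. Then g_i = f^{(λ)}_{i,j} for all i ≥ j−1; i.e. the solution with these initial conditions is unique and is given by the integrals f^{(λ)}_{i,j}. -/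

import Mathlib

open MeasureTheory

namespace Ultra
open Polynomial

/-- The ultraspherical differential operator. -/
noncomputable def M (lam : ℝ) (p : ℝ[X]) : ℝ[X] :=
  (1 - X ^ 2) * derivative (derivative p) - (2 * C lam + 1) * X * derivative p

lemma wt_left (s : ℝ) (hs : -1 < s) :
    IntervalIntegrable (fun t : ℝ => (1 - t ^ 2) ^ s) volume (-1) 0 := by
  have h1 : IntervalIntegrable (fun t : ℝ => (t + 1) ^ s) volume (-1) 0 := by
    have := (intervalIntegral.intervalIntegrable_rpow' (a := 0) (b := 1) hs).comp_add_right 1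
    simpa using this
  have h2 : ContinuousOn (fun t : ℝ => (1 - t) ^ s) (Set.uIcc (-1) 0) := by
    rw [Set.uIcc_of_le (by norm_num)]
    intro t ht
    apply ContinuousAt.continuousWithinAt
    apply ContinuousAt.rpow_const (by fun_prop)
    left
    linarith [ht.2]
  have h3 := h1.mul_continuousOn h2
  refine h3.congr ?_
  intro t ht
  rw [Set.uIoc_of_le (by norm_num)] at ht
  simp only
  rw [← Real.mul_rpow (by linarith [ht.1]) (by linarith [ht.2])]
  congr 1; ring

lemma wt_int (s : ℝ) (hs : -1 < s) :
    IntervalIntegrable (fun t : ℝ => (1 - t ^ 2) ^ s) volume (-1) 1 := by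
  refine (wt_left s hs).trans ?_
  have := (IntervalIntegrable.iff_comp_neg (f := fun t : ℝ => (1 - t ^ 2) ^ s)).1 (wt_left s hs)
  simpa using this.symm

lemma poly_int (s : ℝ) (hs : -1 < s) (p : ℝ[X]) :
    IntervalIntegrable (fun t : ℝ => p.eval t * (1 - t ^ 2) ^ s) volume (-1) 1 :=
  (wt_int s hs).continuousOn_mul p.continuous.continuousOn

/-- The weight functional on polynomials. -/
noncomputable def I (s : ℝ) (hs : -1 < s) : ℝ[X] →ₗ[ℝ] ℝ where
  toFun p := ∫ t in (-1:ℝ)..1, p.eval t * (1 - t ^ 2) ^ s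
  map_add' p q := by
    rw [← intervalIntegral.integral_add (poly_int s hs p) (poly_int s hs q)]
    congr 1; ext t; simp; ring
  map_smul' c p := by
    rw [RingHom.id_apply, smul_eq_mul, ← intervalIntegral.integral_const_mul]
    congr 1; ext t; simp; ring

lemma I_parts (lam : ℝ) (hs : -1 < lam - 1 / 2) (r : ℝ[X]) :
    I (lam - 1 / 2) hs ((1 - X ^ 2) * derivative r - (2 * C lam + 1) * X * r) = 0 := by
  have key := intervalIntegral.integral_eq_sub_of_hasDerivAt_of_le (a := -1) (b := 1)
    (f := fun t : ℝ => r.eval t * (1 - t ^ 2) ^ (lam + 1 / 2))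
    (f' := fun t : ℝ => ((1 - X ^ 2) * derivative r - (2 * C lam + 1) * X * r).eval t
      * (1 - t ^ 2) ^ (lam - 1 / 2)) (by norm_num) ?_ ?_ (poly_int _ hs _)
  · change (∫ t in (-1:ℝ)..1, _) = 0
    rw [key]
    have : lam + 1 / 2 ≠ 0 := by linarith
    norm_num [Real.zero_rpow this]
  · apply ContinuousOn.mul r.continuous.continuousOn
    apply ContinuousOn.rpow_const (by fun_prop)
    intro x _; right; linarith
  · intro t ht
    have hpos : 0 < 1 - t ^ 2 := by nlinarith [ht.1, ht.2]
    have h1 : HasDerivAt (fun t : ℝ => 1 - t ^ 2) (-(2 * t)) t := by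
      have := ((hasDerivAt_id t).pow 2).const_sub 1
      simpa using this
    have h2 := (r.hasDerivAt t).mul (h1.rpow_const (p := lam + 1 / 2) (Or.inl hpos.ne'))
    refine h2.congr_deriv ?_
    have e1 : lam + 1 / 2 - 1 = lam - 1 / 2 := by ring
    have e2 : (1 - t ^ 2) ^ (lam + 1 / 2) = (1 - t ^ 2) ^ (lam - 1 / 2) * (1 - t ^ 2) := by
      rw [← Real.rpow_add_one hpos.ne']; congr 1; ring
    rw [e1, e2]
    simp; ring

lemma change_var (s : ℝ) (hs : -1 < s) (p q : ℝ[X]) :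
    (∫ t in (0:ℝ)..1, p.eval t * q.eval (2 * t - 1) * (t * (1 - t)) ^ s)
      = ((1 / 4 : ℝ) ^ s / 2) * I s hs (p.comp (C (1 / 2) * (X + 1)) * q) := by
  have := intervalIntegral.integral_comp_mul_sub (a := 0) (b := 1)
    (fun x : ℝ => (p.comp (C (1 / 2) * (X + 1)) * q).eval x * (1 - x ^ 2) ^ s)
    (c := 2) (by norm_num) 1
  norm_num at this
  have e : I s hs (p.comp (C (1 / 2) * (X + 1)) * q)
      = 2 * ∫ t in (0:ℝ)..1, (p.comp (C (1 / 2) * (X + 1)) * q).eval (2 * t - 1)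
          * (1 - (2 * t - 1) ^ 2) ^ s := by
    change (∫ t in (-1:ℝ)..1, _) = _
    norm_num
    rw [this]; ring
  rw [e, ← mul_assoc, ← intervalIntegral.integral_const_mul]
  apply intervalIntegral.integral_congr
  intro t ht
  rw [Set.uIcc_of_le (by norm_num)] at ht
  have h0 : 0 ≤ t * (1 - t) := mul_nonneg ht.1 (by linarith [ht.2])
  have e1 : 1 - (2 * t - 1) ^ 2 = 4 * (t * (1 - t)) := by ring
  have e3 : (1 / 4 : ℝ) ^ s * 4 ^ s = 1 := by
    rw [← Real.mul_rpow (by norm_num) (by norm_num)]; norm_num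
  have e4 : (1 / 2 : ℝ) * (2 * t - 1 + 1) = t := by ring
  simp only [e1]
  rw [Real.mul_rpow (by norm_num) h0]
  simp only [eval_mul, eval_comp, eval_C, eval_add, eval_X, eval_one, e4]
  linear_combination (-(eval t p * eval (2 * t - 1) q * (t * (1 - t)) ^ s)) * e3

lemma M_symm (lam : ℝ) (J : ℝ[X] →ₗ[ℝ] ℝ)
    (hJ : ∀ r : ℝ[X], J ((1 - X ^ 2) * derivative r - (2 * C lam + 1) * X * r) = 0)
    (p q : ℝ[X]) : J (M lam p * q) = J (p * M lam q) := by
  have h := hJ (derivative p * q - p * derivative q)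
  rw [← sub_eq_zero, ← map_sub, ← h]
  congr 1
  simp only [M, derivative_sub, derivative_mul]
  ring

/-- Coefficients of `M`. -/
lemma M_coeff (lam : ℝ) (p : ℝ[X]) (k : ℕ) :
    (M lam p).coeff k = (k + 2) * (k + 1) * p.coeff (k + 2) - k * (k + 2 * lam) * p.coeff k := by
  have e : M lam p = derivative (derivative p) - X ^ 2 * derivative (derivative p)
      - C (2 * lam + 1) * (X * derivative p) := by
    simp only [M, C_add, C_mul, C_1, show (C 2 : ℝ[X]) = 2 from rfl]; ring
  rw [e, coeff_sub, coeff_sub, coeff_C_mul]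
  rcases k with _ | _ | k
  · simp [coeff_derivative, coeff_X_pow_mul']; ring
  · simp [coeff_derivative, coeff_X_pow_mul', coeff_X_mul]; ring
  · have : k + 1 + 1 = k + 2 := rfl
    rw [coeff_X_pow_mul, coeff_X_mul]
    simp [coeff_derivative]; ring

lemma eig_coeff (lam : ℝ) (hlam : lam > -(1 / 2)) (n : ℕ) (d : ℝ[X])
    (hd : M lam d = C (-((n : ℝ) * (n + 2 * lam))) * d) (h0 : d.coeff n = 0) : d = 0 := by
  by_contra hne
  have hl : d.coeff d.natDegree ≠ 0 := by simpa using hne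
  have hc := congrArg (fun q => coeff q d.natDegree) hd
  simp only [M_coeff, coeff_C_mul] at hc
  rw [coeff_eq_zero_of_natDegree_lt (show d.natDegree < d.natDegree + 2 by omega)] at hc
  set m := d.natDegree
  have hmn : m ≠ n := fun h => hl (h ▸ h0)
  have h2 : ((m : ℝ) - n) * (m + n + 2 * lam) = 0 := by
    have : (((m : ℝ) - n) * (m + n + 2 * lam)) * d.coeff m = 0 := by linear_combination -hc
    exact (mul_eq_zero.1 this).resolve_right hl
  rcases mul_eq_zero.1 h2 with h | h
  · exact hmn (by exact_mod_cast sub_eq_zero.1 h)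
  · have : (1 : ℝ) ≤ m + n := by
      have : 1 ≤ m + n := by omega
      exact_mod_cast this
    linarith

section
variable (P : ℕ → ℝ[X]) (hdeg : ∀ n, (P n).natDegree = n)
  (hlead : ∀ n, 0 < (P n).leadingCoeff)

lemma kpos (P : ℕ → ℝ[X]) (hdeg : ∀ n, (P n).natDegree = n)
  (hlead : ∀ n, 0 < (P n).leadingCoeff) (n : ℕ) : 0 < (P n).coeff n := by
  have := hlead n
  rwa [leadingCoeff, hdeg n] at this

lemma span (P : ℕ → ℝ[X]) (hdeg : ∀ n, (P n).natDegree = n)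
  (hlead : ∀ n, 0 < (P n).leadingCoeff) (n : ℕ) : ∀ q : ℝ[X], q.degree < n →
    ∃ c : ℕ → ℝ, q = ∑ k ∈ Finset.range n, C (c k) * P k := by
  induction n with
  | zero => intro q hq; exact ⟨0, by simpa using hq⟩
  | succ n ih =>
    intro q hq
    have hk := kpos P hdeg hlead n
    obtain ⟨c, hc⟩ := ih (q - C (q.coeff n / (P n).coeff n) * P n) (by
      rw [degree_lt_iff_coeff_zero]
      intro m hm
      rcases hm.eq_or_lt with rfl | hm
      · simp [coeff_C_mul]; field_simp; simp
      · rw [degree_lt_iff_coeff_zero] at hq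
        rw [coeff_sub, coeff_C_mul, hq m (by omega),
          coeff_eq_zero_of_natDegree_lt (show (P n).natDegree < m by rw [hdeg]; exact hm)]
        simp)
    refine ⟨fun k => if k = n then q.coeff n / (P n).coeff n else c k, ?_⟩
    rw [Finset.sum_range_succ]
    have : ∑ k ∈ Finset.range n, C (if k = n then q.coeff n / (P n).coeff n else c k) * P k
        = ∑ k ∈ Finset.range n, C (c k) * P k := by
      apply Finset.sum_congr rfl
      intro k hk
      rw [if_neg (by have := Finset.mem_range.1 hk; omega)]
    rw [this, ← hc]; simp

lemma J_C_mul (J : ℝ[X] →ₗ[ℝ] ℝ) (a : ℝ) (p : ℝ[X]) : J (C a * p) = a * J p := by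
  rw [← smul_eq_C_mul, map_smul, smul_eq_mul]

lemma orth_low (P : ℕ → ℝ[X]) (hdeg : ∀ n, (P n).natDegree = n)
  (hlead : ∀ n, 0 < (P n).leadingCoeff) (J : ℝ[X] →ₗ[ℝ] ℝ)
    (hJ : ∀ k l, J (P k * P l) = if k = l then 1 else 0) (n : ℕ) (q : ℝ[X])
    (hq : q.degree < n) : J (q * P n) = 0 := by
  obtain ⟨c, hc⟩ := span P hdeg hlead n q hq
  rw [hc, Finset.sum_mul, map_sum]
  apply Finset.sum_eq_zero
  intro k hk
  rw [mul_assoc, J_C_mul, hJ, if_neg (by have := Finset.mem_range.1 hk; omega), mul_zero]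

lemma zero_of_orth (P : ℕ → ℝ[X]) (hdeg : ∀ n, (P n).natDegree = n)
  (hlead : ∀ n, 0 < (P n).leadingCoeff) (J : ℝ[X] →ₗ[ℝ] ℝ)
    (hJ : ∀ k l, J (P k * P l) = if k = l then 1 else 0) (n : ℕ) (q : ℝ[X])
    (hq : q.degree < n) (h : ∀ k < n, J (q * P k) = 0) : q = 0 := by
  obtain ⟨c, hc⟩ := span P hdeg hlead n q hq
  rw [hc]
  apply Finset.sum_eq_zero
  intro k hk
  have h2 := h k (Finset.mem_range.1 hk)
  rw [hc, Finset.sum_mul, map_sum, Finset.sum_eq_single k] at h2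
  · rw [mul_assoc, J_C_mul, hJ, if_pos rfl, mul_one] at h2
    simp [h2]
  · intro b _ hb
    rw [mul_assoc, J_C_mul, hJ, if_neg hb, mul_zero]
  · intro hk'; exact absurd hk hk'
end

lemma ode (lam : ℝ) (P : ℕ → ℝ[X]) (hdeg : ∀ n, (P n).natDegree = n)
  (hlead : ∀ n, 0 < (P n).leadingCoeff) (J : ℝ[X] →ₗ[ℝ] ℝ)
    (hJ : ∀ k l, J (P k * P l) = if k = l then 1 else 0)
    (hJ0 : ∀ r : ℝ[X], J ((1 - X ^ 2) * derivative r - (2 * C lam + 1) * X * r) = 0) (n : ℕ) :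
    M lam (P n) = C (-((n : ℝ) * (n + 2 * lam))) * P n := by
  rw [← sub_eq_zero]
  apply zero_of_orth P hdeg hlead J hJ n
  · rw [degree_lt_iff_coeff_zero]
    intro m hm
    rw [coeff_sub, coeff_C_mul, M_coeff,
      coeff_eq_zero_of_natDegree_lt (show (P n).natDegree < m + 2 by rw [hdeg]; omega)]
    rcases hm.eq_or_lt with rfl | hm
    · ring
    · rw [coeff_eq_zero_of_natDegree_lt (show (P n).natDegree < m by rw [hdeg]; omega)]
      ring
  · intro k hk
    rw [sub_mul, map_sub, M_symm lam J hJ0, mul_assoc, J_C_mul, hJ, if_neg (by omega), mul_zero,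
      sub_zero, mul_comm]
    apply orth_low P hdeg hlead J hJ
    rw [degree_lt_iff_coeff_zero]
    intro m hm
    rw [M_coeff, coeff_eq_zero_of_natDegree_lt (show (P k).natDegree < m by rw [hdeg]; omega),
      coeff_eq_zero_of_natDegree_lt (show (P k).natDegree < m + 2 by rw [hdeg]; omega)]
    ring

lemma M_sub_C (lam c : ℝ) (p q : ℝ[X]) : M lam (p - C c * q) = M lam p - C c * M lam q := by
  simp only [M, derivative_sub, derivative_mul, derivative_C, zero_mul, zero_add]; ring

lemma eig_eq (lam : ℝ) (hlam : lam > -(1 / 2)) (n : ℕ) (p d : ℝ[X])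
    (hp : M lam p = C (-((n : ℝ) * (n + 2 * lam))) * p) (hk : p.coeff n ≠ 0)
    (hd : M lam d = C (-((n : ℝ) * (n + 2 * lam))) * d) :
    d = C (d.coeff n / p.coeff n) * p := by
  rw [← sub_eq_zero]
  apply eig_coeff lam hlam n
  · rw [M_sub_C, hp, hd]; ring
  · rw [coeff_sub, coeff_C_mul]; field_simp; simp

/-- raising -/
noncomputable def U (lam : ℝ) (n : ℕ) (p : ℝ[X]) : ℝ[X] :=
  ((n : ℝ[X]) + 2 * C lam) * X * p - (1 - X ^ 2) * derivative p
/-- lowering -/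
noncomputable def V (n : ℕ) (p : ℝ[X]) : ℝ[X] :=
  (1 - X ^ 2) * derivative p + (n : ℝ[X]) * X * p

lemma ode' {lam : ℝ} {n : ℕ} {p : ℝ[X]} (hp : M lam p = C (-((n : ℝ) * (n + 2 * lam))) * p) :
    (1 - X ^ 2) * derivative (derivative p) - (2 * C lam + 1) * X * derivative p
      = -((n : ℝ[X]) * ((n : ℝ[X]) + 2 * C lam)) * p := by
  have h := hp
  simp only [M, C_neg, C_mul, C_add, show (C 2 : ℝ[X]) = 2 from rfl,
    show (C (n : ℝ) : ℝ[X]) = n from by simp] at h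
  exact h

lemma dU {lam : ℝ} {n : ℕ} {p : ℝ[X]} (hp : M lam p = C (-((n : ℝ) * (n + 2 * lam))) * p) :
    derivative (U lam n p) = ((n : ℝ[X]) + 1) * (((n : ℝ[X]) + 2 * C lam) * p + X * derivative p) := by
  have h := ode' hp
  simp [U]
  linear_combination -h

lemma dV {lam : ℝ} {n : ℕ} {p : ℝ[X]} (hp : M lam p = C (-((n : ℝ) * (n + 2 * lam))) * p) :
    derivative (V n p) = ((n : ℝ[X]) + 2 * C lam - 1) * (X * derivative p - (n : ℝ[X]) * p) := by
  have h := ode' hp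
  simp [V]
  linear_combination h

lemma MU {lam : ℝ} {n : ℕ} {p : ℝ[X]} (hp : M lam p = C (-((n : ℝ) * (n + 2 * lam))) * p) :
    M lam (U lam n p) = C (-(((n + 1 : ℕ) : ℝ) * ((n + 1 : ℕ) + 2 * lam))) * U lam n p := by
  have h := ode' hp
  unfold M
  rw [dU hp]
  simp only [C_neg, C_mul, C_add, show (C 2 : ℝ[X]) = 2 from rfl, Nat.cast_add, Nat.cast_one,
    show (C (n : ℝ) : ℝ[X]) = n from by simp, C_1, U]
  simp
  linear_combination ((n : ℝ[X]) + 1) * X * h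

lemma MV {lam : ℝ} {n : ℕ} {p : ℝ[X]}
    (hp : M lam p = C (-(((n + 1 : ℕ) : ℝ) * ((n + 1 : ℕ) + 2 * lam))) * p) :
    M lam (V (n + 1) p) = C (-((n : ℝ) * (n + 2 * lam))) * V (n + 1) p := by
  have h := ode' hp
  unfold M
  rw [dV hp]
  simp only [C_neg, C_mul, C_add, show (C 2 : ℝ[X]) = 2 from rfl,
    show (C (n : ℝ) : ℝ[X]) = n from by simp, C_1, V]
  simp at h ⊢
  linear_combination ((n : ℝ[X]) + 2 * C lam) * X * h

lemma VU {lam : ℝ} {n : ℕ} {p : ℝ[X]} (hp : M lam p = C (-((n : ℝ) * (n + 2 * lam))) * p) :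
    V (n + 1) (U lam n p) = C (((n : ℝ) + 1) * (n + 2 * lam)) * p := by
  unfold V
  rw [dU hp]
  simp only [C_mul, C_add, show (C 2 : ℝ[X]) = 2 from rfl, Nat.cast_add, Nat.cast_one,
    show (C (n : ℝ) : ℝ[X]) = n from by simp, C_1, U]
  ring

lemma V_C (n : ℕ) (c : ℝ) (p : ℝ[X]) : V n (C c * p) = C c * V n p := by
  simp only [V, derivative_mul, derivative_C, zero_mul, zero_add]; ring

lemma UV (lam : ℝ) (n : ℕ) (p : ℝ[X]) :
    U lam n p + V n p = C (2 * (n + lam)) * (X * p) := by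
  simp only [C_mul, C_add, show (C 2 : ℝ[X]) = 2 from rfl,
    show (C (n : ℝ) : ℝ[X]) = n from by simp, U, V]
  ring

/-- Explicit ladder relations. -/
lemma ladder (lam : ℝ) (hlam : lam > -(1 / 2)) (P : ℕ → ℝ[X]) (hdeg : ∀ n, (P n).natDegree = n)
  (hlead : ∀ n, 0 < (P n).leadingCoeff) (J : ℝ[X] →ₗ[ℝ] ℝ)
    (hJ : ∀ k l, J (P k * P l) = if k = l then 1 else 0)
    (hJ0 : ∀ r : ℝ[X], J ((1 - X ^ 2) * derivative r - (2 * C lam + 1) * X * r) = 0) :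
    ∃ (a b : ℕ → ℝ), (∀ n, 1 ≤ n → 0 < a n) ∧
      (∀ n, 1 ≤ n → a n ^ 2 * (4 * (n + lam) * (n + 1 + lam)) = (n + 1) * (n + 2 * lam)) ∧
      (∀ n, 1 ≤ n → U lam n (P n) = C (2 * (n + lam) * a n) * P (n + 1)) ∧
      (∀ n, V (n + 1) (P (n + 1)) = C (2 * (n + 1 + lam) * b n) * P n) ∧
      (∀ n, 1 ≤ n → b n = a n) := by
  have hode := ode lam P hdeg hlead J hJ hJ0
  have hk := kpos P hdeg hlead
  have hU : ∀ n, U lam n (P n) = C (2 * (n + lam) * ((P n).coeff n / (P (n + 1)).coeff (n + 1)))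
      * P (n + 1) := by
    intro n
    have h := eig_eq lam hlam (n + 1) (P (n + 1)) _ (hode _) (hk _).ne' (MU (hode n))
    have hc : (U lam n (P n)).coeff (n + 1) = 2 * (n + lam) * (P n).coeff n := by
      have e : U lam n (P n) = C (n + 2 * lam) * (X * P n)
        - derivative (P n) + X * (X * derivative (P n)) := by
        simp only [C_mul, C_add, show (C 2 : ℝ[X]) = 2 from rfl,
          show (C (n : ℝ) : ℝ[X]) = n from by simp, U]
        ring
      rw [e, coeff_add, coeff_sub, coeff_C_mul, coeff_X_mul, coeff_X_mul, coeff_derivative,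
        coeff_eq_zero_of_natDegree_lt (show (P n).natDegree < n + 1 + 1 by rw [hdeg]; omega)]
      rcases n with _ | n
      · simp
      · rw [coeff_X_mul, coeff_derivative]; push_cast; ring
    rw [h, hc]
    congr 2
    ring
  have hV : ∀ n, ∃ b, V (n + 1) (P (n + 1)) = C (2 * (n + 1 + lam) * b) * P n := by
    intro n
    have h := eig_eq lam hlam n (P n) _ (hode _) (hk _).ne' (MV (hode (n + 1)))
    have hpos : (n : ℝ) + 1 + lam ≠ 0 := by
      have : (0 : ℝ) ≤ n := Nat.cast_nonneg n
      linarith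
    refine ⟨(V (n + 1) (P (n + 1))).coeff n / (P n).coeff n / (2 * (n + 1 + lam)), ?_⟩
    rw [mul_div_cancel₀ _ (by simpa using hpos)]
    exact h
  choose b hb using hV
  have hba : ∀ n, 1 ≤ n → b n = (P n).coeff n / (P (n + 1)).coeff (n + 1) := by
    intro n hn
    have hn' : (1 : ℝ) ≤ n := by exact_mod_cast hn
    have h1 := congrArg (fun q => J (q * P n)) (UV lam (n + 1) (P (n + 1)))
    have h2 := congrArg (fun q => J (q * P (n + 1))) (UV lam n (P n))
    obtain ⟨m, rfl⟩ : ∃ m, n = m + 1 := ⟨n - 1, by omega⟩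
    simp only [hU, hb, add_mul, map_add, mul_assoc, J_C_mul, hJ] at h1 h2
    rw [if_neg (by omega), if_pos trivial] at h1
    rw [if_pos trivial, if_neg (by omega)] at h2
    push_cast at h1 h2
    have e : J (X * (P (m + 1 + 1) * P (m + 1))) = J (X * (P (m + 1) * P (m + 1 + 1))) := by
      congr 1; ring
    rw [e] at h1
    have p1 : (m : ℝ) + 1 + lam ≠ 0 := by push_cast at hn'; linarith
    have p2 : (m : ℝ) + 1 + 1 + lam ≠ 0 := by push_cast at hn'; linarith
    have h1' : b (m + 1) = J (X * (P (m + 1) * P (m + 1 + 1))) := by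
      apply mul_left_cancel₀ p2
      linear_combination h1 / 2
    rw [h1']
    apply mul_left_cancel₀ p1
    linear_combination -h2 / 2
  refine ⟨fun n => (P n).coeff n / (P (n + 1)).coeff (n + 1), b,
    fun n _ => div_pos (hk _) (hk _), ?_, fun n _ => hU n, hb, hba⟩
  intro n hn
  have h := VU (hode n)
  rw [hU, V_C, hb, hba n hn] at h
  have hc := congrArg (fun q => coeff q n) h
  simp only [coeff_C_mul] at hc
  have hc' : (2 * (n + lam) * ((P n).coeff n / (P (n + 1)).coeff (n + 1))) *
      (2 * (n + 1 + lam) * ((P n).coeff n / (P (n + 1)).coeff (n + 1)))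
      = (n + 1) * (n + 2 * lam) := by
    apply mul_right_cancel₀ (hk n).ne'
    linear_combination hc
  linear_combination hc'

/-- The key integrated identity. -/
lemma core (lam : ℝ) (n : ℕ) (hn : (n : ℝ) + lam ≠ 0) (p : ℝ[X]) (K : ℝ)
    (hp : M lam p = C (-((n : ℝ) * (n + 2 * lam))) * p)
    (F : ℝ[X] →ₗ[ℝ] ℝ)
    (hF : ∀ q : ℝ[X], F (2 * X * (1 - X) * derivative (derivative q)
        + (2 * C lam + 1) * (1 - 2 * X) * derivative q) = -(2 * K) * F q)
    (σ τ : ℝ) (hσ : σ * (n + 1) * (2 * (n + lam)) = 2 * n + 2 * lam - 1)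
    (hτ : C (2 * (n + lam)) * (C τ * derivative (V n p))
      = (2 * (n : ℝ[X]) + 2 * C lam + 1) * (X * derivative p - (n : ℝ[X]) * p)) :
    2 * (n + lam) * (2 * K * (σ * F (U lam n p) + 2 * F p + τ * F (V n p)))
      = 2 * (2 * lam + 1) * (n * F (U lam n p) - (n + 2 * lam) * F (V n p))
        + (4 * n * (n + 2 * lam) + 2 * (4 * lam ^ 2 - 1)) * (F (U lam n p) + F (V n p))
        - (4 * lam ^ 2 - 1) * (2 * (n + lam)) * F p := by
  have h := ode' hp
  set w : ℝ[X] := C σ * U lam n p + C 2 * p + C τ * V n p with hw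
  have hCne : (C (2 * (n + lam)) : ℝ[X]) ≠ 0 := C_ne_zero.2 (mul_ne_zero two_ne_zero hn)
  have hCe : (C (2 * (n + lam)) : ℝ[X]) = 2 * (n + C lam) := by
    simp only [C_mul, C_add, show (C 2 : ℝ[X]) = 2 from rfl,
      show (C (n : ℝ) : ℝ[X]) = n from by simp]
  have hσ' : (C σ : ℝ[X]) * (n + 1) * (2 * (n + C lam)) = 2 * n + 2 * C lam - 1 := by
    have := congrArg (C : ℝ → ℝ[X]) hσ
    simpa only [C_mul, C_add, C_sub, show (C 2 : ℝ[X]) = 2 from rfl, C_1,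
      show (C (n : ℝ) : ℝ[X]) = n from by simp] using this
  have dw : derivative w = 2 * (1 + X) * derivative p + (2 * C lam - 1) * p := by
    apply mul_left_cancel₀ hCne
    have e : derivative w = C σ * derivative (U lam n p) + 2 * derivative p
        + C τ * derivative (V n p) := by
      rw [hw]; simp only [derivative_add, derivative_mul, derivative_C, zero_mul, zero_add]; rfl
    rw [e, dU hp, mul_add, mul_add, hτ, hCe]
    linear_combination (((n : ℝ[X]) + 2 * C lam) * p + X * derivative p) * hσ'
  have hFw := hF w
  have hFw' : F w = σ * F (U lam n p) + 2 * F p + τ * F (V n p) := by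
    rw [hw, map_add, map_add, J_C_mul, J_C_mul, J_C_mul]
  rw [← hFw']
  have hL : C (2 * (n + lam)) * (2 * X * (1 - X) * derivative (derivative w)
        + (2 * C lam + 1) * (1 - 2 * X) * derivative w)
      = C (-(2 * (2 * lam + 1) * n + (4 * n * (n + 2 * lam) + 2 * (4 * lam ^ 2 - 1))))
          * U lam n p
        + C (2 * (2 * lam + 1) * (n + 2 * lam)
          - (4 * n * (n + 2 * lam) + 2 * (4 * lam ^ 2 - 1))) * V n p
        + C ((4 * lam ^ 2 - 1) * (2 * (n + lam))) * p := by
    rw [dw]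
    simp only [derivative_add, derivative_mul, derivative_sub, derivative_C, derivative_X,
      derivative_one, derivative_ofNat, C_neg, C_mul, C_add, C_sub, C_pow,
      show (C 2 : ℝ[X]) = 2 from rfl, show (C 4 : ℝ[X]) = 4 from rfl, C_1,
      show (C (n : ℝ) : ℝ[X]) = n from by simp, U, V]
    linear_combination (2 * ((n : ℝ[X]) + C lam)) * (4 * X) * h
  have hFL := congrArg F hL
  simp only [map_add, J_C_mul] at hFL
  rw [← map_add, hFw] at hFL
  linear_combination -hFL

lemma comp_L (lam : ℝ) (q : ℝ[X]) :
    (2 * X * (1 - X) * derivative (derivative q)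
        + (2 * C lam + 1) * (1 - 2 * X) * derivative q).comp (C (1 / 2) * (X + 1))
      = 2 * M lam (q.comp (C (1 / 2) * (X + 1))) := by
  have h2 : (2 : ℝ[X]) * C (1 / 2) = 1 := by
    rw [show (2 : ℝ[X]) = C 2 from rfl, ← C_mul]; norm_num
  simp only [M, derivative_comp, derivative_mul, derivative_add, derivative_C, derivative_X,
    derivative_one, mul_comp, add_comp, sub_comp, X_comp, C_comp, one_comp, ofNat_comp]
  generalize (derivative (derivative q)).comp (C (1 / 2) * (X + 1)) = A
  generalize (derivative q).comp (C (1 / 2) * (X + 1)) = B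
  generalize (C (1 / 2) : ℝ[X]) = h at *
  simp only [zero_mul, zero_add, add_zero, mul_one, derivative_zero]
  linear_combination -(2 * h * (X + 1) * A + (2 * C lam + 1) * B) * h2
lemma algebra (i lam K A B σ τ x y gp g gm : ℝ) (hi : i + lam ≠ 0)
    (hA : A = 2 * (i + lam) * (i + 1) * x * gp) (hσ : σ * A = (2 * i + 2 * lam - 1) * x * gp)
    (hB : B = 2 * (i + lam) * (i - 1 + 2 * lam) * y * gm)
    (hτ : τ * B = (2 * i + 2 * lam + 1) * y * gm)
    (h : 2 * (i + lam) * (2 * K * (σ * A + 2 * g + τ * B))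
      = 2 * (2 * lam + 1) * (i * A - (i + 2 * lam) * B)
        + (4 * i * (i + 2 * lam) + 2 * (4 * lam ^ 2 - 1)) * (A + B)
        - (4 * lam ^ 2 - 1) * (2 * (i + lam)) * g) :
    2 * ((i + lam) ^ 2 - 1 / 4) * (i + lam + 3 / 2) * (2 * x) * gp
      + 2 * ((i + lam) ^ 2 - 1 / 4) * (i + lam - 3 / 2) * (2 * y) * gm
    = (K + lam ^ 2 - 1 / 4) * (2 * (i + lam - 1 / 2) * (2 * x) * gp + 4 * g
      + 2 * (i + lam + 1 / 2) * (2 * y) * gm) := by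
  rw [hσ, hτ, hA, hB] at h
  apply mul_left_cancel₀ (mul_ne_zero two_ne_zero hi)
  linear_combination -h

/-- Twisted functional. -/
noncomputable def Fj (J : ℝ[X] →ₗ[ℝ] ℝ) (q : ℝ[X]) : ℝ[X] →ₗ[ℝ] ℝ where
  toFun p := J (p.comp (C (1 / 2) * (X + 1)) * q)
  map_add' p r := by rw [add_comp, add_mul, map_add]
  map_smul' c p := by rw [smul_comp, smul_mul_assoc, map_smul, RingHom.id_apply]

lemma Fj_zero (P : ℕ → ℝ[X]) (hdeg : ∀ n, (P n).natDegree = n)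
    (hlead : ∀ n, 0 < (P n).leadingCoeff) (J : ℝ[X] →ₗ[ℝ] ℝ)
    (hJ : ∀ k l, J (P k * P l) = if k = l then 1 else 0) (i j : ℕ) (hij : i < j) :
    Fj J (P j) (P i) = 0 := by
  apply orth_low P hdeg hlead J hJ
  have h1 : (C (1 / 2) * (X + 1) : ℝ[X]).natDegree ≤ 1 := by compute_degree
  have h2 : ((P i).comp (C (1 / 2) * (X + 1))).natDegree ≤ i := by
    refine natDegree_comp_le.trans ?_
    rw [hdeg]; nlinarith
  exact (degree_le_natDegree.trans (Nat.cast_le.2 h2)).trans_lt (by exact_mod_cast hij)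

lemma Fj_rec (lam : ℝ) (hlam : lam > -(1 / 2)) (P : ℕ → ℝ[X]) (hdeg : ∀ n, (P n).natDegree = n)
    (hlead : ∀ n, 0 < (P n).leadingCoeff) (J : ℝ[X] →ₗ[ℝ] ℝ)
    (hJ : ∀ k l, J (P k * P l) = if k = l then 1 else 0)
    (hJ0 : ∀ r : ℝ[X], J ((1 - X ^ 2) * derivative r - (2 * C lam + 1) * X * r) = 0)
    (j : ℕ) (hj : 0 < j) (i : ℕ) (hij : j ≤ i) :
    2 * (((i : ℝ) + lam) ^ 2 - 1 / 4) * ((i : ℝ) + lam + 3 / 2) *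
          Real.sqrt (((i : ℝ) + 2 * lam) /
            (((i : ℝ) + 1) * ((i : ℝ) + lam + 1) * ((i : ℝ) + lam))) * Fj J (P j) (P (i + 1))
        + 2 * (((i : ℝ) + lam) ^ 2 - 1 / 4) * ((i : ℝ) + lam - 3 / 2) *
          Real.sqrt ((i : ℝ) /
            (((i : ℝ) - 1 + lam) * ((i : ℝ) - 1 + 2 * lam) * ((i : ℝ) + lam)))
            * Fj J (P j) (P (i - 1))
      = ((j : ℝ) + lam - 1 / 2) * ((j : ℝ) + lam + 1 / 2) *
          (2 * ((i : ℝ) + lam - 1 / 2) *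
              Real.sqrt (((i : ℝ) + 2 * lam) /
                (((i : ℝ) + 1) * ((i : ℝ) + lam + 1) * ((i : ℝ) + lam))) * Fj J (P j) (P (i + 1))
            + 4 * Fj J (P j) (P i)
            + 2 * ((i : ℝ) + lam + 1 / 2) *
              Real.sqrt ((i : ℝ) /
                (((i : ℝ) - 1 + lam) * ((i : ℝ) - 1 + 2 * lam) * ((i : ℝ) + lam))) *
              Fj J (P j) (P (i - 1))) := by
  have hode := ode lam P hdeg hlead J hJ hJ0
  obtain ⟨a, b, ha, ha2, hU, hV, hba⟩ := ladder lam hlam P hdeg hlead J hJ hJ0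
  have hi1 : 1 ≤ i := by omega
  have hiR : (1 : ℝ) ≤ i := by exact_mod_cast hi1
  have p1 : 0 < (i : ℝ) + lam := by linarith
  have p2 : 0 < (i : ℝ) + lam + 1 := by linarith
  have p3 : 0 < (i : ℝ) + 2 * lam := by linarith
  have p4 : 0 < (i : ℝ) + 1 := by linarith
  have hF : ∀ q : ℝ[X], Fj J (P j) (2 * X * (1 - X) * derivative (derivative q)
        + (2 * C lam + 1) * (1 - 2 * X) * derivative q)
        = -(2 * ((j : ℝ) * (j + 2 * lam))) * Fj J (P j) q := by
    intro q
    change J (_ * _) = _ * J (_ * _)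
    rw [comp_L, show (2 : ℝ[X]) = C 2 from rfl, mul_assoc, J_C_mul, M_symm lam J hJ0, hode,
      show ∀ A : ℝ[X], ∀ r : ℝ, A * (C r * P j) = C r * (A * P j) from fun A r => by ring,
      J_C_mul]
    ring
  have hS : Real.sqrt (((i : ℝ) + 2 * lam) / (((i : ℝ) + 1) * ((i : ℝ) + lam + 1)
      * ((i : ℝ) + lam))) = 2 * (a i / (i + 1)) := by
    rw [show ((i : ℝ) + 2 * lam) / (((i : ℝ) + 1) * ((i : ℝ) + lam + 1)
      * ((i : ℝ) + lam)) = (2 * (a i / (i + 1))) ^ 2 by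
        have := ha2 i hi1
        field_simp
        linear_combination -this]
    apply Real.sqrt_sq
    have := ha i hi1
    positivity
  have hFU : Fj J (P j) (U lam i (P i))
      = 2 * (i + lam) * (i + 1) * (a i / (i + 1)) * Fj J (P j) (P (i + 1)) := by
    rw [hU i hi1, J_C_mul]; field_simp
  have hKe : ((j : ℝ) + lam - 1 / 2) * ((j : ℝ) + lam + 1 / 2)
      = (j : ℝ) * (j + 2 * lam) + lam ^ 2 - 1 / 4 := by ring
  rw [hS, hKe]
  rcases hi1.eq_or_lt with h1 | h2
  · subst h1
    have hj1 : j = 1 := by omega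
    subst hj1
    have hz : Fj J (P 1) (P (1 - 1)) = 0 := Fj_zero P hdeg hlead J hJ _ _ (by norm_num)
    have hFV : Fj J (P 1) (V 1 (P 1)) = 0 := by
      have := hV 0
      simp only [zero_add] at this
      rw [this, J_C_mul]
      simp only [Nat.sub_self] at hz
      rw [hz, mul_zero]
    have hXp : X * derivative (P 1) = P 1 := by
      have h := ode' (hode 1)
      have hd : derivative (derivative (P 1)) = 0 := by
        ext k
        rw [coeff_derivative, coeff_derivative,
          coeff_eq_zero_of_natDegree_lt (show (P 1).natDegree < k + 1 + 1 by rw [hdeg]; omega)]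
        simp
      rw [hd] at h
      have hne : (C (2 * lam + 1) : ℝ[X]) ≠ 0 := C_ne_zero.2 (by linarith)
      apply mul_left_cancel₀ hne
      simp only [C_add, C_mul, C_1, show (C 2 : ℝ[X]) = 2 from rfl]
      push_cast at h
      linear_combination -h
    have hc := core lam 1 p1.ne' (P 1) _ (hode 1) _ hF
      ((2 * (1 : ℕ) + 2 * lam - 1) / (((1 : ℕ) + 1) * (2 * ((1 : ℕ) + lam)))) 0
      (by field_simp) (by rw [hXp]; simp)
    have := algebra _ lam _ _ _ _ _ (a 1 / ((1 : ℕ) + 1))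
      (Real.sqrt (((1 : ℕ) : ℝ) / ((((1 : ℕ) : ℝ) - 1 + lam) * (((1 : ℕ) : ℝ) - 1 + 2 * lam)
        * (((1 : ℕ) : ℝ) + lam))) / 2) (Fj J (P 1) (P (1 + 1)))
      (Fj J (P 1) (P 1)) (Fj J (P 1) (P (1 - 1))) p1.ne'
      hFU (by rw [hFU]; field_simp) (by rw [hFV, hz, mul_zero]) (by rw [hFV, hz]; ring) hc
    rw [hz] at this ⊢
    linear_combination this
  · obtain ⟨n, rfl⟩ : ∃ n, i = n + 1 := ⟨i - 1, by omega⟩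
    have hn1 : 1 ≤ n := by omega
    have hnR : (1 : ℝ) ≤ n := by exact_mod_cast hn1
    have q1 : 0 < (n : ℝ) + lam := by linarith
    have q2 : 0 < (n : ℝ) + 2 * lam := by linarith
    have q3 : 0 < (n : ℝ) + 1 + lam := by linarith
    have e1 : ((n + 1 : ℕ) : ℝ) - 1 + lam = n + lam := by push_cast; ring
    have e2 : ((n + 1 : ℕ) : ℝ) - 1 + 2 * lam = n + 2 * lam := by push_cast; ring
    have hT : Real.sqrt (((n + 1 : ℕ) : ℝ) / ((((n + 1 : ℕ) : ℝ) - 1 + lam)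
        * (((n + 1 : ℕ) : ℝ) - 1 + 2 * lam) * (((n + 1 : ℕ) : ℝ) + lam)))
        = 2 * (a n / (n + 2 * lam)) := by
      rw [e1, e2]
      push_cast
      rw [show ((n : ℝ) + 1) / (((n : ℝ) + lam) * ((n : ℝ) + 2 * lam) * ((n : ℝ) + 1 + lam))
          = (2 * (a n / (n + 2 * lam))) ^ 2 by
        have h3 := ha2 n hn1
        have hy : a n = a n / (n + 2 * lam) * (n + 2 * lam) := (div_mul_cancel₀ _ q2.ne').symm
        generalize a n / (n + 2 * lam) = y at hy
        rw [hy] at h3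
        rw [div_eq_iff (mul_pos (mul_pos q1 q2) q3).ne']
        apply mul_left_cancel₀ q2.ne'
        linear_combination -h3]
      apply Real.sqrt_sq
      have := ha n hn1
      positivity
    have hFV : Fj J (P j) (V (n + 1) (P (n + 1)))
        = 2 * ((n + 1 : ℕ) + lam) * ((n + 1 : ℕ) - 1 + 2 * lam) * (a n / (n + 2 * lam))
          * Fj J (P j) (P (n + 1 - 1)) := by
      rw [hV n, J_C_mul, hba n hn1, e2, Nat.add_sub_cancel]
      push_cast
      field_simp
    have hc := core lam (n + 1) p1.ne' (P (n + 1)) _ (hode _) _ hF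
      ((2 * (n + 1 : ℕ) + 2 * lam - 1) / (((n + 1 : ℕ) + 1) * (2 * ((n + 1 : ℕ) + lam))))
      ((2 * (n + 1 : ℕ) + 2 * lam + 1) / ((n + 2 * lam) * (2 * ((n + 1 : ℕ) + lam))))
      (by field_simp) (by
        rw [dV (hode (n + 1)), ← mul_assoc, ← mul_assoc, ← C_mul]
        congr 1
        rw [show (((n + 1 : ℕ) : ℝ[X]) + 2 * C lam - 1) = C ((n : ℝ) + 2 * lam) by
            simp only [C_add, C_mul, show (C 2 : ℝ[X]) = 2 from rfl, Nat.cast_add, Nat.cast_one,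
              show (C (n : ℝ) : ℝ[X]) = n from by simp]
            ring,
          show (2 * ((n + 1 : ℕ) : ℝ[X]) + 2 * C lam + 1)
            = C (2 * ((n + 1 : ℕ) : ℝ) + 2 * lam + 1) by
            simp only [C_add, C_mul, show (C 2 : ℝ[X]) = 2 from rfl, C_1,
              show (C ((n + 1 : ℕ) : ℝ) : ℝ[X]) = ((n + 1 : ℕ) : ℝ[X]) from by simp],
          ← C_mul]
        congr 1
        field_simp)
    have := algebra _ lam _ _ _ _ _ (a (n + 1) / ((n + 1 : ℕ) + 1))
      (a n / (n + 2 * lam)) (Fj J (P j) (P (n + 1 + 1)))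
      (Fj J (P j) (P (n + 1))) (Fj J (P j) (P (n + 1 - 1))) p1.ne'
      hFU (by rw [hFU]; field_simp) hFV (by rw [hFV, e2]; field_simp) hc
    rw [hT]
    exact this

end Ultra


/-- for fixed `j > 0`, the solution of the recurrence
\eqref{recurge} in `i` with initial conditions `g_{j-1} = 0` and
`g_j = ∫_0^1 p̂_j^{(λ)}(t) p̂_j^{(λ)}(2t-1)(t(1-t))^{λ-1/2} dt` is unique and
given by `g_i = f^{(λ)}_{i,j}` for all `i ≥ j-1`. -/
theorem stmt_15
    (lam : ℝ) (hlam : lam > -(1 / 2))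
    (P : ℕ → Polynomial ℝ)
    (hdeg : ∀ n, (P n).natDegree = n)
    (hlead : ∀ n, 0 < (P n).leadingCoeff)
    (horth : ∀ k l, (∫ t in (-1:ℝ)..1,
        (P k).eval t * (P l).eval t * (1 - t ^ 2) ^ (lam - 1 / 2)) =
      if k = l then 1 else 0)
    (f : ℕ → ℕ → ℝ)
    (hf : ∀ i j, f i j = ∫ t in (0:ℝ)..1,
      (P i).eval t * (P j).eval (2 * t - 1) * (t * (1 - t)) ^ (lam - 1 / 2))
    (j : ℕ) (hj : 0 < j)
    (g : ℕ → ℝ)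
    (hrec : ∀ i : ℕ, j ≤ i →
      2 * (((i : ℝ) + lam) ^ 2 - 1 / 4) * ((i : ℝ) + lam + 3 / 2) *
          Real.sqrt (((i : ℝ) + 2 * lam) /
            (((i : ℝ) + 1) * ((i : ℝ) + lam + 1) * ((i : ℝ) + lam))) * g (i + 1)
        + 2 * (((i : ℝ) + lam) ^ 2 - 1 / 4) * ((i : ℝ) + lam - 3 / 2) *
          Real.sqrt ((i : ℝ) /
            (((i : ℝ) - 1 + lam) * ((i : ℝ) - 1 + 2 * lam) * ((i : ℝ) + lam))) * g (i - 1)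
      = ((j : ℝ) + lam - 1 / 2) * ((j : ℝ) + lam + 1 / 2) *
          (2 * ((i : ℝ) + lam - 1 / 2) *
              Real.sqrt (((i : ℝ) + 2 * lam) /
                (((i : ℝ) + 1) * ((i : ℝ) + lam + 1) * ((i : ℝ) + lam))) * g (i + 1)
            + 4 * g i
            + 2 * ((i : ℝ) + lam + 1 / 2) *
              Real.sqrt ((i : ℝ) /
                (((i : ℝ) - 1 + lam) * ((i : ℝ) - 1 + 2 * lam) * ((i : ℝ) + lam))) *
              g (i - 1)))
    (hinit0 : g (j - 1) = 0)
    (hinit1 : g j = ∫ t in (0:ℝ)..1,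
      (P j).eval t * (P j).eval (2 * t - 1) * (t * (1 - t)) ^ (lam - 1 / 2)) :
    ∀ i : ℕ, j - 1 ≤ i → g i = f i j := by
  have hs : -1 < lam - 1 / 2 := by linarith
  have hJ : ∀ k l, Ultra.I (lam - 1 / 2) hs (P k * P l) = if k = l then 1 else 0 := by
    intro k l
    rw [← horth k l]
    change (∫ t in (-1:ℝ)..1, _) = _
    simp only [Polynomial.eval_mul]
  have hJ0 := Ultra.I_parts lam hs
  obtain ⟨c, hc⟩ : ∃ c : ℝ, ∀ i, f i j
      = c * Ultra.Fj (Ultra.I (lam - 1 / 2) hs) (P j) (P i) :=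
    ⟨_, fun i => by rw [hf, Ultra.change_var _ hs]; rfl⟩
  have hz := Ultra.Fj_zero P hdeg hlead _ hJ (j - 1) j (by omega)
  have hR := Ultra.Fj_rec lam hlam P hdeg hlead _ hJ hJ0 j hj
  have hg0 : g (j - 1) = f (j - 1) j := by rw [hinit0, hc, hz, mul_zero]
  have hg1 : g j = f j j := by rw [hinit1, hf]
  have hstep : ∀ i, j ≤ i → g i = f i j ∧ g (i - 1) = f (i - 1) j := by
    intro i hi
    induction i, hi using Nat.le_induction with
    | base => exact ⟨hg1, hg0⟩
    | succ i hi ih =>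
      obtain ⟨h1, h2⟩ := ih
      refine ⟨?_, by simpa using h1⟩
      have hA := hrec i hi
      have hB := hR i hi
      rw [h1, h2, hc i, hc (i - 1)] at hA
      rw [hc]
      have hjR : (1 : ℝ) ≤ j := by exact_mod_cast hj
      have hiR : (j : ℝ) ≤ i := by exact_mod_cast hi
      have hSpos : 0 < Real.sqrt (((i : ℝ) + 2 * lam) /
            (((i : ℝ) + 1) * ((i : ℝ) + lam + 1) * ((i : ℝ) + lam))) := by
        apply Real.sqrt_pos.2
        apply div_pos (by linarith)
        exact mul_pos (mul_pos (by linarith) (by linarith)) (by linarith)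
      generalize Real.sqrt (((i : ℝ) + 2 * lam) /
            (((i : ℝ) + 1) * ((i : ℝ) + lam + 1) * ((i : ℝ) + lam))) = S at *
      have hco : 0 < 2 * ((i : ℝ) + lam - 1 / 2) * S * (((i : ℝ) + lam + 1 / 2)
          * ((i : ℝ) + lam + 3 / 2) - ((j : ℝ) + lam - 1 / 2) * ((j : ℝ) + lam + 1 / 2)) := by
        apply mul_pos (mul_pos (by linarith) hSpos)
        nlinarith
      apply mul_left_cancel₀ hco.ne'
      linear_combination hA - c * hB
  intro i hi
  rcases Nat.lt_or_ge i j with h | h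
  · have : i = j - 1 := by omega
    rw [this, hg0]
  · exact (hstep i h).1
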